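/- (Flux bounds in the laminar regime) For all constants C₁ > 0, C₂ > 0 there exists C₈ > 0 with the following property. Let κ ∈ (0,1) and W = 4π²κ. Let u : Ω → ℝ² be a smooth divergence-free vector field with ∫₀¹ u₁(x₁,x₂) dx₂ = 0 for all x₁, whose vorticity ω = ∂₁u₂ − ∂₂u₁ satisfies ‖ω‖_{L∞(Ω)} ≤ W. Write u = (0, m(x₁))ᵀ + û where m(x₁) = ∫₀¹ u₂(x₁,x₂) dx₂, and suppose |∂₁m| ≤ W, ‖û‖_{L∞(Ω)} ≤ C₁W, there is a smooth v₁ with ∂₂v₁ = u₁ = û₁ and ‖v₁‖_{L∞(Ω)} ≤ C₁W, and p : Ω → ℝ is smooth with ‖p‖_{L∞(Ω)} ≤ C₂W². Define ê(x₁) = (1/2)∫₀¹ |û(x₁,x₂)|² dx₂, ĥ(x₁) = ∫₀¹ (p + (1/2)|û|²) û₁ dx₂, d̂(x₁) = ∫₀¹ |∇û(x₁,x₂)|² dx₂, f̂ = ∂₁ê − ĥ, and ĝ(x₁) = (∂₁m(x₁)) ∫₀¹ û₁(x₁,x₂) û₂(x₁,x₂) dx₂. Then for every x₁ ∈ ℝ: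 ê(x₁) ≤ d̂(x₁)/(8π²), |f̂(x₁)|² ≤ C₈ κ² d̂(x₁), and |ĝ(x₁)| ≤ κ d̂(x₁). -/

import Mathlib

noncomputable section

open MeasureTheory Real

namespace NS

/-- First partial derivative of a function on `ℝ²`. -/
def pd1 (g : ℝ × ℝ → ℝ) (x : ℝ × ℝ) : ℝ := deriv (fun y => g (y, x.2)) x.1

/-- Second partial derivative of a function on `ℝ²`. -/
def pd2 (g : ℝ × ℝ → ℝ) (x : ℝ × ℝ) : ℝ := deriv (fun y => g (x.1, y)) x.2

/-- Euclidean square norm of a vector in `ℝ²`. -/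
def vnorm2 (v : ℝ × ℝ) : ℝ := v.1 ^ 2 + v.2 ^ 2

/-- Euclidean norm of a vector in `ℝ²`. -/
def vnorm (v : ℝ × ℝ) : ℝ := Real.sqrt (vnorm2 v)

/-- Vorticity `ω = ∂₁u₂ - ∂₂u₁`. -/
def vort (u : ℝ × ℝ → ℝ × ℝ) (x : ℝ × ℝ) : ℝ :=
  pd1 (fun y => (u y).2) x - pd2 (fun y => (u y).1) x

/-- Squared norm of the full velocity gradient. -/
def gradsq (u : ℝ × ℝ → ℝ × ℝ) (x : ℝ × ℝ) : ℝ :=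
  pd1 (fun y => (u y).1) x ^ 2 + pd2 (fun y => (u y).1) x ^ 2
    + pd1 (fun y => (u y).2) x ^ 2 + pd2 (fun y => (u y).2) x ^ 2

/-- Mean vertical speed `m(x₁) = ∫₀¹ u₂(x₁,x₂) dx₂`. -/
def mAvg (u : ℝ × ℝ → ℝ × ℝ) (y : ℝ) : ℝ := ∫ x₂ in (0:ℝ)..1, (u (y, x₂)).2

/-- Oscillating part `û = u - (0, m)ᵀ`. -/
def uhat (u : ℝ × ℝ → ℝ × ℝ) (x : ℝ × ℝ) : ℝ × ℝ :=
  ((u x).1, (u x).2 - mAvg u x.1)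

/-- Energy density of the oscillating part `ê(x₁) = (1/2)∫₀¹ |û|² dx₂`. -/
def eHat (u : ℝ × ℝ → ℝ × ℝ) (y : ℝ) : ℝ :=
  (1/2) * ∫ x₂ in (0:ℝ)..1, vnorm2 (uhat u (y, x₂))

/-- Inviscid flux `ĥ(x₁) = ∫₀¹ (p + |û|²/2) û₁ dx₂`. -/
def hHat (u : ℝ × ℝ → ℝ × ℝ) (pr : ℝ × ℝ → ℝ) (y : ℝ) : ℝ :=
  ∫ x₂ in (0:ℝ)..1, (pr (y, x₂) + (1/2) * vnorm2 (uhat u (y, x₂))) * (uhat u (y, x₂)).1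

/-- Dissipation rate `d̂(x₁) = ∫₀¹ |∇û|² dx₂`. -/
def dHat (u : ℝ × ℝ → ℝ × ℝ) (y : ℝ) : ℝ :=
  ∫ x₂ in (0:ℝ)..1, gradsq (uhat u) (y, x₂)

/-- Extra term `ĝ(x₁) = (∂₁m)(x₁) ∫₀¹ û₁ û₂ dx₂`. -/
def gHat (u : ℝ × ℝ → ℝ × ℝ) (y : ℝ) : ℝ :=
  deriv (mAvg u) y * ∫ x₂ in (0:ℝ)..1, (uhat u (y, x₂)).1 * (uhat u (y, x₂)).2

/-- Wirtinger's inequality with the sharp constant on the unit interval. -/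
lemma wirtinger_unitInterval {f f' : ℝ → ℝ} (hf : ∀ x, HasDerivAt f (f' x) x)
    (hf' : Continuous f') (hper : f 1 = f 0) (hmean : ∫ t in (0:ℝ)..1, f t = 0) :
    4 * π ^ 2 * ∫ t in (0:ℝ)..1, f t ^ 2 ≤ ∫ t in (0:ℝ)..1, f' t ^ 2 := by
  have hfc : Continuous f := continuous_iff_continuousAt.2 fun x => (hf x).continuousAt
  have parseval : ∀ g : ℝ → ℝ, Continuous g →
      HasSum (fun n : ℤ => ‖fourierCoeffOn zero_lt_one (fun t => (g t : ℂ)) n‖ ^ 2)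
        (∫ t in (0:ℝ)..1, g t ^ 2) := by
    intro g hg
    have hL2 : MemLp (fun t => (g t : ℂ)) 2 (volume.restrict (Set.Ioc (0:ℝ) 1)) := by
      have hc : Continuous fun t => (g t : ℂ) := by fun_prop
      rw [memLp_two_iff_integrable_sq_norm hc.aestronglyMeasurable]
      exact (hc.norm.pow 2).integrableOn_Ioc
    have h := hasSum_sq_fourierCoeffOn zero_lt_one hL2
    simpa using h
  refine hasSum_le (fun n => ?_) ((parseval f hfc).mul_left (4 * π ^ 2)) (parseval f' hf')
  by_cases hn : n = 0
  · subst hn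
    have h0 : fourierCoeffOn zero_lt_one (fun t => (f t : ℂ)) 0 = 0 := by
      rw [fourierCoeffOn_eq_integral]
      simp [intervalIntegral.integral_ofReal, hmean]
    rw [h0]
    simp
  · have hd : ∀ x ∈ Set.uIcc (0:ℝ) 1, HasDerivAt (fun t => (f t : ℂ)) (f' x : ℂ) x :=
      fun x _ => (hf x).ofReal_comp
    have hc : Continuous fun t => (f' t : ℂ) := by fun_prop
    have h := fourierCoeffOn_of_hasDerivAt zero_lt_one hn hd (hc.intervalIntegrable _ _)
    rw [hper] at h
    rw [h]
    have hn1 : (1:ℝ) ≤ (n:ℝ) ^ 2 := by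
      have : (1:ℤ) ≤ n ^ 2 := by have := sq_pos_of_ne_zero hn; omega
      exact_mod_cast this
    simp only [norm_mul, norm_div, norm_neg, mul_pow, div_pow, sub_self, mul_zero, zero_sub,
      Complex.norm_I, Complex.norm_real, Complex.norm_intCast, norm_one, Real.norm_eq_abs, sq_abs,
      one_pow, Complex.norm_ofNat, Complex.ofReal_one, Complex.ofReal_zero, sub_zero, one_mul,
      mul_one]
    set c := ‖fourierCoeffOn zero_lt_one (fun t => (f' t : ℂ)) n‖ ^ 2
    have hc0 : 0 ≤ c := sq_nonneg _
    have hpi : 0 < π ^ 2 := by positivity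
    have : 4 * π ^ 2 * (1 / (2 ^ 2 * π ^ 2 * (n:ℝ) ^ 2) * c) = c / (n:ℝ) ^ 2 := by
      field_simp
      norm_num
    rw [this]
    exact div_le_self hc0 hn1

/-- Differentiation under the integral sign over the unit interval. -/
lemma hasDerivAt_integral_unitInterval {F F' : ℝ × ℝ → ℝ} (hF : Continuous F)
    (hF' : Continuous F') (h : ∀ x : ℝ × ℝ, HasDerivAt (fun y => F (y, x.2)) (F' x) x.1) (y : ℝ) :
    HasDerivAt (fun y => ∫ t in (0:ℝ)..1, F (y, t)) (∫ t in (0:ℝ)..1, F' (y, t)) y := by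
  obtain ⟨C, hC⟩ := ((isCompact_closedBall y 1).prod
    (isCompact_Icc (a := (0:ℝ)) (b := 1))).exists_bound_of_continuousOn hF'.continuousOn
  refine (intervalIntegral.hasDerivAt_integral_of_dominated_loc_of_deriv_le
    (F := fun y t => F (y, t)) (F' := fun y t => F' (y, t)) (bound := fun _ => C)
    (Metric.closedBall_mem_nhds y one_pos) ?_ ?_ ?_ ?_ ?_ ?_).2
  · exact Filter.Eventually.of_forall fun x =>
      (by fun_prop : Continuous fun t => F (x, t)).aestronglyMeasurable
  · exact (by fun_prop : Continuous fun t => F (y, t)).intervalIntegrable _ _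
  · exact (by fun_prop : Continuous fun t => F' (y, t)).aestronglyMeasurable
  · refine Filter.Eventually.of_forall fun t ht x hx => hC (x, t) ⟨hx, ?_⟩
    rw [Set.uIoc_of_le zero_le_one] at ht
    exact Set.Ioc_subset_Icc_self ht
  · exact intervalIntegrable_const
  · exact Filter.Eventually.of_forall fun t _ x _ => h (x, t)

/-- The square of a mean is at most the mean of the square. -/
lemma sq_integral_unitInterval_le {φ : ℝ → ℝ} (hφ : Continuous φ) :
    (∫ t in (0:ℝ)..1, φ t) ^ 2 ≤ ∫ t in (0:ℝ)..1, φ t ^ 2 := by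
  set c := ∫ t in (0:ℝ)..1, φ t with hc
  have h : 0 ≤ ∫ t in (0:ℝ)..1, (φ t - c) ^ 2 :=
    intervalIntegral.integral_nonneg zero_le_one fun t _ => sq_nonneg _
  have e : ∀ t, (φ t - c) ^ 2 = φ t ^ 2 - 2 * c * φ t + c ^ 2 := fun t => by ring
  simp_rw [e] at h
  rw [intervalIntegral.integral_add
      ((by fun_prop : Continuous fun t => φ t ^ 2 - 2 * c * φ t).intervalIntegrable _ _)
      intervalIntegrable_const,
    intervalIntegral.integral_sub
      ((by fun_prop : Continuous fun t => φ t ^ 2).intervalIntegrable _ _)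
      ((by fun_prop : Continuous fun t => 2 * c * φ t).intervalIntegrable _ _),
    intervalIntegral.integral_const_mul, intervalIntegral.integral_const, ← hc] at h
  simp only [sub_zero, one_smul] at h
  nlinarith

lemma integral_unitInterval_mono {φ ψ : ℝ → ℝ} (hφ : Continuous φ) (hψ : Continuous ψ)
    (h : ∀ t, φ t ≤ ψ t) : ∫ t in (0:ℝ)..1, φ t ≤ ∫ t in (0:ℝ)..1, ψ t :=
  intervalIntegral.integral_mono_on zero_le_one (hφ.intervalIntegrable _ _)
    (hψ.intervalIntegrable _ _) fun t _ => h t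

lemma integral_unitInterval_add {φ ψ : ℝ → ℝ} (hφ : Continuous φ) (hψ : Continuous ψ) :
    ∫ t in (0:ℝ)..1, (φ t + ψ t) = (∫ t in (0:ℝ)..1, φ t) + ∫ t in (0:ℝ)..1, ψ t :=
  intervalIntegral.integral_add (hφ.intervalIntegrable _ _) (hψ.intervalIntegrable _ _)

lemma hasDerivAt_pd1 {g : ℝ × ℝ → ℝ} (hg : ContDiff ℝ (⊤ : ℕ∞) g) (x : ℝ × ℝ) :
    HasDerivAt (fun y => g (y, x.2)) (pd1 g x) x.1 := by
  have h : ContDiff ℝ (⊤ : ℕ∞) fun y => g (y, x.2) := by fun_prop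
  exact (h.differentiable (by simp) x.1).hasDerivAt

lemma hasDerivAt_pd2 {g : ℝ × ℝ → ℝ} (hg : ContDiff ℝ (⊤ : ℕ∞) g) (x : ℝ × ℝ) :
    HasDerivAt (fun y => g (x.1, y)) (pd2 g x) x.2 := by
  have h : ContDiff ℝ (⊤ : ℕ∞) fun y => g (x.1, y) := by fun_prop
  exact (h.differentiable (by simp) x.2).hasDerivAt

lemma continuous_pd1 {g : ℝ × ℝ → ℝ} (hg : ContDiff ℝ (⊤ : ℕ∞) g) : Continuous (pd1 g) := by
  have e : pd1 g = fun x => fderiv ℝ g x (1, 0) := by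
    funext x
    have h1 : HasFDerivAt g (fderiv ℝ g x) (x.1, x.2) :=
      (hg.differentiable (by simp) x).hasFDerivAt
    exact (h1.comp_hasDerivAt x.1 ((hasDerivAt_id x.1).prodMk (hasDerivAt_const x.1 x.2))).deriv
  rw [e]
  exact (hg.continuous_fderiv (by simp)).clm_apply continuous_const

lemma continuous_pd2 {g : ℝ × ℝ → ℝ} (hg : ContDiff ℝ (⊤ : ℕ∞) g) : Continuous (pd2 g) := by
  have e : pd2 g = fun x => fderiv ℝ g x (0, 1) := by
    funext x
    have h1 : HasFDerivAt g (fderiv ℝ g x) (x.1, x.2) :=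
      (hg.differentiable (by simp) x).hasFDerivAt
    exact (h1.comp_hasDerivAt x.2 ((hasDerivAt_const x.2 x.1).prodMk (hasDerivAt_id x.2))).deriv
  rw [e]
  exact (hg.continuous_fderiv (by simp)).clm_apply continuous_const

/-- `(∫ v · w)² ≤ M² ∫ |w|²` when the vector field `v = (P, Q)` is bounded by `M`. -/
lemma sq_integral_inner_le {P Q P' Q' : ℝ → ℝ} {M : ℝ} (hP : Continuous P) (hQ : Continuous Q)
    (hP' : Continuous P') (hQ' : Continuous Q') (hM : ∀ t, P t ^ 2 + Q t ^ 2 ≤ M ^ 2) :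
    (∫ t in (0:ℝ)..1, (P t * P' t + Q t * Q' t)) ^ 2 ≤
      M ^ 2 * ∫ t in (0:ℝ)..1, (P' t ^ 2 + Q' t ^ 2) := by
  rw [← intervalIntegral.integral_const_mul]
  refine (sq_integral_unitInterval_le (by fun_prop)).trans
    (integral_unitInterval_mono (by fun_prop) (by fun_prop) fun t => ?_)
  have h := mul_le_mul_of_nonneg_right (hM t) (by positivity : 0 ≤ P' t ^ 2 + Q' t ^ 2)
  nlinarith [sq_nonneg (P t * Q' t - Q t * P' t)]

/-- `(∫ (R + |v|²/2) P)² ≤ (A + M²/2)² ∫ P²` when `|R| ≤ A` and `v = (P, Q)` is bounded by `M`. -/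
lemma sq_integral_flux_le {P Q R : ℝ → ℝ} {A M : ℝ} (hP : Continuous P) (hQ : Continuous Q)
    (hR : Continuous R) (hA : ∀ t, |R t| ≤ A) (hM : ∀ t, P t ^ 2 + Q t ^ 2 ≤ M ^ 2) :
    (∫ t in (0:ℝ)..1, (R t + 1 / 2 * (P t ^ 2 + Q t ^ 2)) * P t) ^ 2 ≤
      (A + M ^ 2 / 2) ^ 2 * ∫ t in (0:ℝ)..1, P t ^ 2 := by
  rw [← intervalIntegral.integral_const_mul]
  refine (sq_integral_unitInterval_le (by fun_prop)).trans
    (integral_unitInterval_mono (by fun_prop) (by fun_prop) fun t => ?_)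
  rw [mul_pow]
  refine mul_le_mul_of_nonneg_right ?_ (sq_nonneg _)
  obtain ⟨h₁, h₂⟩ := abs_le.1 (hA t)
  have h₃ := hM t
  apply sq_le_sq' <;> nlinarith [sq_nonneg (P t), sq_nonneg (Q t)]

/-- `|∫ P Q| ≤ (1/2) (∫ P² + ∫ Q²)`. -/
lemma abs_integral_mul_le {P Q : ℝ → ℝ} (hP : Continuous P) (hQ : Continuous Q) :
    |∫ t in (0:ℝ)..1, P t * Q t| ≤
      1 / 2 * ((∫ t in (0:ℝ)..1, P t ^ 2) + ∫ t in (0:ℝ)..1, Q t ^ 2) := by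
  rw [← integral_unitInterval_add (by fun_prop) (by fun_prop),
    ← intervalIntegral.integral_const_mul]
  refine (intervalIntegral.abs_integral_le_integral_abs zero_le_one).trans
    (integral_unitInterval_mono (by fun_prop) (by fun_prop) fun t => ?_)
  rw [abs_le]
  constructor <;> nlinarith [sq_nonneg (P t + Q t), sq_nonneg (P t - Q t)]

/-- Combination of bounds on the two parts `a`, `b` of the flux, where `w = 4π²`. -/
lemma sq_sub_le_of_flux_bounds {a b C K w κ D I : ℝ} (hw : 0 < w) (hκ0 : 0 < κ) (hκ1 : κ < 1)
    (ha : a ^ 2 ≤ (C * (w * κ)) ^ 2 * D) (hb : b ^ 2 ≤ (K * (w * κ) ^ 2) ^ 2 * I)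
    (hI : w * I ≤ D) (hD : 0 ≤ D) :
    (a - b) ^ 2 ≤ (2 * C ^ 2 * w ^ 2 + 2 * K ^ 2 * w ^ 3) * κ ^ 2 * D := by
  have hκ : κ ^ 4 ≤ κ ^ 2 := pow_le_pow_of_le_one hκ0.le hκ1.le (by norm_num)
  calc (a - b) ^ 2 ≤ 2 * a ^ 2 + 2 * b ^ 2 := by nlinarith [sq_nonneg (a + b)]
    _ ≤ 2 * ((C * (w * κ)) ^ 2 * D) + 2 * ((K * (w * κ) ^ 2) ^ 2 * I) := by gcongr
    _ = 2 * C ^ 2 * w ^ 2 * κ ^ 2 * D + 2 * K ^ 2 * w ^ 3 * κ ^ 4 * (w * I) := by ring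
    _ ≤ 2 * C ^ 2 * w ^ 2 * κ ^ 2 * D + 2 * K ^ 2 * w ^ 3 * κ ^ 4 * D := by gcongr
    _ ≤ 2 * C ^ 2 * w ^ 2 * κ ^ 2 * D + 2 * K ^ 2 * w ^ 3 * κ ^ 2 * D := by gcongr
    _ = _ := by ring

/-- Flux bounds in the laminar regime: with `W = 4π²κ`, `κ ∈ (0,1)` and `f̂ = ∂₁ê - ĥ`,
`ê ≤ d̂/(8π²)`, `|f̂|² ≤ C₈κ²d̂`, and `|ĝ| ≤ κd̂`. -/
theorem laminar_flux_bounds :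
    ∀ C₁ > (0:ℝ), ∀ C₂ > (0:ℝ), ∃ C₈ > (0:ℝ),
      ∀ κ : ℝ, 0 < κ → κ < 1 →
      ∀ (u : ℝ × ℝ → ℝ × ℝ) (v₁ pr : ℝ × ℝ → ℝ),
      ContDiff ℝ (⊤ : ℕ∞) u →
      (∀ x : ℝ × ℝ, u (x.1, x.2 + 1) = u x) →
      (∀ x : ℝ × ℝ, pd1 (fun y => (u y).1) x + pd2 (fun y => (u y).2) x = 0) →
      (∀ x₁ : ℝ, (∫ x₂ in (0:ℝ)..1, (u (x₁, x₂)).1) = 0) →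
      (∀ x : ℝ × ℝ, |vort u x| ≤ 4 * π ^ 2 * κ) →
      (∀ x₁ : ℝ, |deriv (mAvg u) x₁| ≤ 4 * π ^ 2 * κ) →
      (∀ x : ℝ × ℝ, vnorm (uhat u x) ≤ C₁ * (4 * π ^ 2 * κ)) →
      ContDiff ℝ (⊤ : ℕ∞) v₁ →
      (∀ x : ℝ × ℝ, v₁ (x.1, x.2 + 1) = v₁ x) →
      (∀ x : ℝ × ℝ, pd2 v₁ x = (u x).1) →
      (∀ x : ℝ × ℝ, |v₁ x| ≤ C₁ * (4 * π ^ 2 * κ)) →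
      ContDiff ℝ (⊤ : ℕ∞) pr →
      (∀ x : ℝ × ℝ, pr (x.1, x.2 + 1) = pr x) →
      (∀ x : ℝ × ℝ, |pr x| ≤ C₂ * (4 * π ^ 2 * κ) ^ 2) →
      ∀ x₁ : ℝ,
        eHat u x₁ ≤ dHat u x₁ / (8 * π ^ 2) ∧
        (deriv (eHat u) x₁ - hHat u pr x₁) ^ 2 ≤ C₈ * κ ^ 2 * dHat u x₁ ∧
        |gHat u x₁| ≤ κ * dHat u x₁ := by
  intro C₁ hC₁ C₂ hC₂
  refine ⟨2 * C₁ ^ 2 * (4 * π ^ 2) ^ 2 + 2 * (C₂ + C₁ ^ 2 / 2) ^ 2 * (4 * π ^ 2) ^ 3,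
    by positivity, ?_⟩
  intro κ hκ0 hκ1 u v₁ pr hu hper _ hmean _ hm' hû _ _ _ _ hpr _ hprb x₁
  set W := 4 * π ^ 2 * κ with hW
  have hu1 : ContDiff ℝ (⊤ : ℕ∞) fun y => (u y).1 := by fun_prop
  have hu2 : ContDiff ℝ (⊤ : ℕ∞) fun y => (u y).2 := by fun_prop
  have hu1c := hu1.continuous
  have hu2c := hu2.continuous
  set a1 := pd1 fun y => (u y).1
  set a2 := pd2 fun y => (u y).1
  set b1 := pd1 fun y => (u y).2
  set b2 := pd2 fun y => (u y).2
  have ca1 : Continuous a1 := continuous_pd1 hu1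
  have ca2 : Continuous a2 := continuous_pd2 hu1
  have cb1 : Continuous b1 := continuous_pd1 hu2
  have cb2 : Continuous b2 := continuous_pd2 hu2
  have da1 : ∀ x, HasDerivAt (fun y => (u (y, x.2)).1) (a1 x) x.1 := hasDerivAt_pd1 hu1
  have da2 : ∀ x, HasDerivAt (fun y => (u (x.1, y)).1) (a2 x) x.2 := hasDerivAt_pd2 hu1
  have db1 : ∀ x, HasDerivAt (fun y => (u (y, x.2)).2) (b1 x) x.1 := hasDerivAt_pd1 hu2
  have db2 : ∀ x, HasDerivAt (fun y => (u (x.1, y)).2) (b2 x) x.2 := hasDerivAt_pd2 hu2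
  set m' : ℝ → ℝ := fun y => ∫ t in (0:ℝ)..1, b1 (y, t)
  have dm : ∀ y, HasDerivAt (mAvg u) (m' y) y :=
    hasDerivAt_integral_unitInterval hu2c cb1 db1
  have cm : Continuous (mAvg u) := continuous_iff_continuousAt.2 fun y => (dm y).continuousAt
  have cm' : Continuous m' := by
    apply intervalIntegral.continuous_parametric_intervalIntegral_of_continuous'
    simpa [Function.uncurry_def] using cb1
  -- the components of `û` and its gradient on the line `x₁`
  set P : ℝ → ℝ := fun t => (u (x₁, t)).1 with hP
  set Q : ℝ → ℝ := fun t => (u (x₁, t)).2 - mAvg u x₁ with hQ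
  set P1 : ℝ → ℝ := fun t => a1 (x₁, t) with hP1
  set P2 : ℝ → ℝ := fun t => a2 (x₁, t)
  set Q1 : ℝ → ℝ := fun t => b1 (x₁, t) - m' x₁ with hQ1
  set Q2 : ℝ → ℝ := fun t => b2 (x₁, t)
  set R : ℝ → ℝ := fun t => pr (x₁, t)
  have cP : Continuous P := by fun_prop
  have cQ : Continuous Q := by fun_prop
  have cP1 : Continuous P1 := by fun_prop
  have cP2 : Continuous P2 := by fun_prop
  have cQ1 : Continuous Q1 := by fun_prop
  have cQ2 : Continuous Q2 := by fun_prop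
  have cR : Continuous R := by have := hpr.continuous; fun_prop
  have hperx : u (x₁, 1) = u (x₁, 0) := by simpa using hper (x₁, 0)
  have meanQ : ∫ t in (0:ℝ)..1, Q t = 0 := by
    rw [hQ, intervalIntegral.integral_sub
      ((by fun_prop : Continuous fun t => (u (x₁, t)).2).intervalIntegrable _ _)
      intervalIntegrable_const]
    simp [mAvg]
  have wP := wirtinger_unitInterval (f := P) (f' := P2) (fun t => da2 (x₁, t)) cP2
    (by simp [hP, hperx]) (hmean x₁)
  have wQ := wirtinger_unitInterval (f := Q) (f' := Q2) (fun t => (db2 (x₁, t)).sub_const _) cQ2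
    (by simp [hQ, hperx]) meanQ
  have hD : dHat u x₁ = (∫ t in (0:ℝ)..1, P1 t ^ 2 + Q1 t ^ 2) +
      ((∫ t in (0:ℝ)..1, P2 t ^ 2) + ∫ t in (0:ℝ)..1, Q2 t ^ 2) := by
    rw [← integral_unitInterval_add (by fun_prop) (by fun_prop),
      ← integral_unitInterval_add (by fun_prop) (by fun_prop)]
    refine intervalIntegral.integral_congr fun t _ => ?_
    have e1 : pd1 (fun y => (uhat u y).1) (x₁, t) = P1 t := rfl
    have e2 : pd2 (fun y => (uhat u y).1) (x₁, t) = P2 t := rfl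
    have e3 : pd1 (fun y => (uhat u y).2) (x₁, t) = Q1 t := ((db1 (x₁, t)).sub (dm x₁)).deriv
    have e4 : pd2 (fun y => (uhat u y).2) (x₁, t) = Q2 t := ((db2 (x₁, t)).sub_const (mAvg u x₁)).deriv
    simp only [gradsq, e1, e2, e3, e4]
    ring
  have hE : eHat u x₁ = 1 / 2 * ((∫ t in (0:ℝ)..1, P t ^ 2) + ∫ t in (0:ℝ)..1, Q t ^ 2) := by
    rw [← integral_unitInterval_add (by fun_prop) (by fun_prop)]
    rfl
  have hG0 : 0 ≤ ∫ t in (0:ℝ)..1, P1 t ^ 2 + Q1 t ^ 2 :=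
    intervalIntegral.integral_nonneg zero_le_one fun t _ => by positivity
  have hQ0 : 0 ≤ ∫ t in (0:ℝ)..1, Q t ^ 2 :=
    intervalIntegral.integral_nonneg zero_le_one fun t _ => by positivity
  have hP0 : 0 ≤ ∫ t in (0:ℝ)..1, P t ^ 2 :=
    intervalIntegral.integral_nonneg zero_le_one fun t _ => by positivity
  have hpi : 0 < π ^ 2 := by positivity
  have hW0 : 0 < W := by positivity
  have hPQ : ∀ t, P t ^ 2 + Q t ^ 2 ≤ (C₁ * W) ^ 2 := fun t =>
    (Real.sqrt_le_left (by positivity)).1 (hû (x₁, t))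
  set D := dHat u x₁
  have hED : 8 * π ^ 2 * eHat u x₁ ≤ D := by rw [hE]; nlinarith
  have hPD : 4 * π ^ 2 * (∫ t in (0:ℝ)..1, P t ^ 2) ≤ D := by nlinarith
  have hD0 : 0 ≤ D := le_trans (by positivity) hPD
  refine ⟨by rw [le_div_iff₀ (by positivity)]; linarith, ?_, ?_⟩
  · have hde : HasDerivAt (eHat u) (∫ t in (0:ℝ)..1, (P t * P1 t + Q t * Q1 t)) x₁ := by
      have h := (hasDerivAt_integral_unitInterval
        (F := fun x => vnorm2 (uhat u x))
        (F' := fun x => 2 * ((u x).1 * a1 x + ((u x).2 - mAvg u x.1) * (b1 x - m' x.1)))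
        (by unfold vnorm2 uhat; fun_prop) (by fun_prop) (fun x => by
          have h := ((da1 x).pow 2).add (((db1 x).sub (dm x.1)).pow 2)
          refine h.congr_deriv ?_
          simp only [Pi.sub_apply]
          push_cast
          ring) x₁).const_mul (1 / 2)
      refine h.congr_deriv ?_
      rw [intervalIntegral.integral_const_mul]
      simp only [hP, hQ, hP1, hQ1]
      ring
    have hde2 : deriv (eHat u) x₁ ^ 2 ≤ (C₁ * W) ^ 2 * D := by
      rw [hde.deriv]
      refine (sq_integral_inner_le cP cQ cP1 cQ1 hPQ).trans
        (mul_le_mul_of_nonneg_left ?_ (sq_nonneg _))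
      nlinarith
    have hh2 : hHat u pr x₁ ^ 2 ≤
        ((C₂ + C₁ ^ 2 / 2) * W ^ 2) ^ 2 * ∫ t in (0:ℝ)..1, P t ^ 2 := by
      have h := sq_integral_flux_le cP cQ cR (fun t => hprb (x₁, t)) hPQ
      rwa [show C₂ * W ^ 2 + (C₁ * W) ^ 2 / 2 = (C₂ + C₁ ^ 2 / 2) * W ^ 2 by ring] at h
    exact sq_sub_le_of_flux_bounds (by positivity) hκ0 hκ1 hde2 hh2 hPD hD0
  · have hI : |∫ t in (0:ℝ)..1, P t * Q t| ≤ eHat u x₁ := hE ▸ abs_integral_mul_le cP cQ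
    calc |gHat u x₁| = |deriv (mAvg u) x₁| * |∫ t in (0:ℝ)..1, P t * Q t| := abs_mul _ _
      _ ≤ W * eHat u x₁ := mul_le_mul (hm' x₁) hI (abs_nonneg _) hW0.le
      _ ≤ κ * D := by rw [hW]; nlinarith

end NS
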